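/- Let E ⊆ ℝ be a symmetric Lebesgue-measurable set and ρ > 0. If ρ² is an eigenvalue of 𝓕_E*𝓕_E whose eigenspace has finite dimension κ, then at least one of the four points i^k ρ, k = 0, 1, 2, 3, is an eigenvalue of 𝓕_E, and the sum over k = 0,1,2,3 of the dimensions of the eigenspaces ker(𝓕_E - i^k ρ I) equals κ. In particular, if ρ² is a simple eigenvalue of 𝓕_E*𝓕_E (κ = 1), then exactly one of the four points i^k ρ is an eigenvalue of 𝓕_E, and that eigenvalue is simple. -/

import Mathlib

open MeasureTheory Complex Filter

/-- The truncated Fourier integral transform: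
`(𝓕_E x)(t) = (2π)^{-1/2} ∫_E x(ξ) e^{i t ξ} dξ`. -/
noncomputable def truncatedFourier (E : Set ℝ) (x : ℝ → ℂ) (t : ℝ) : ℂ :=
  (((2 * Real.pi) ^ (-(1:ℝ)/2) : ℝ) : ℂ) * ∫ ξ in E, x ξ * Complex.exp (Complex.I * t * ξ)

/-- The dimension of the span of finitely many independent finite-dimensional subspaces is the sum
of their dimensions. -/
theorem iSupIndep.finrank_iSup {ι K V : Type*} [Fintype ι] [DecidableEq ι] [Field K]
    [AddCommGroup V] [Module K V] {p : ι → Submodule K V} (hp : iSupIndep p)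
    [∀ i, FiniteDimensional K (p i)] :
    Module.finrank K (⨆ i, p i : Submodule K V) = ∑ i, Module.finrank K (p i) := by
  rw [Submodule.iSup_eq_range_dfinsupp_lsum,
    LinearMap.finrank_range_of_inj hp.dfinsupp_lsum_injective]
  exact Module.finrank_directSum K fun i => p i

theorem Complex.I_pow_mul_injective {ρ : ℂ} (hρ : ρ ≠ 0) :
    Function.Injective fun k : Fin 4 => Complex.I ^ (k : ℕ) * ρ := by
  intro a b hab
  have h := mul_right_cancel₀ hρ hab
  fin_cases a <;> fin_cases b <;> simp [Complex.ext_iff, pow_succ] at h ⊢ <;> norm_num at h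

/-- A vector with `f⁴ v = ρ⁴ v`, `ρ ≠ 0`, is a sum of eigenvectors of `f` for the points `iᵏ ρ`. -/
theorem Module.End.mem_iSup_eigenspace_of_pow_four {V : Type*} [AddCommGroup V] [Module ℂ V]
    (f : Module.End ℂ V) {ρ : ℂ} (hρ : ρ ≠ 0) {v : V} (hv : f (f (f (f v))) = ρ ^ 4 • v) :
    v ∈ ⨆ k : Fin 4, f.eigenspace (Complex.I ^ (k : ℕ) * ρ) := by
  have key : ∀ μ : ℂ, μ ^ 4 = ρ ^ 4 →
      μ ^ 3 • v + μ ^ 2 • f v + μ • f (f v) + f (f (f v)) ∈ f.eigenspace μ := by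
    intro μ hμ
    rw [Module.End.mem_eigenspace_iff]
    simp only [map_add, map_smul, hv, ← hμ]
    module
  have hI4 : ∀ k : Fin 4, (Complex.I ^ (k : ℕ) * ρ) ^ 4 = ρ ^ 4 := fun k => by
    rw [mul_pow, ← pow_mul, mul_comm (k : ℕ), pow_mul, Complex.I_pow_four, one_pow, one_mul]
  have hsum : v = ∑ k : Fin 4, ((Complex.I ^ (k : ℕ) * ρ) / (4 * ρ ^ 4)) •
      ((Complex.I ^ (k : ℕ) * ρ) ^ 3 • v + (Complex.I ^ (k : ℕ) * ρ) ^ 2 • f v +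
        (Complex.I ^ (k : ℕ) * ρ) • f (f v) + f (f (f v))) := by
    simp only [Fin.sum_univ_four]
    have hI3 : Complex.I ^ 3 = -Complex.I := Complex.I_pow_three
    match_scalars
    all_goals
      simp only [Fin.isValue, Fin.coe_ofNat_eq_mod]
      norm_num [mul_pow, hI3, neg_pow]
      field_simp
      ring_nf
      try simp [Complex.I_sq]
      try ring
  rw [hsum]
  exact Submodule.sum_mem _ fun k _ => Submodule.smul_mem _ _
    (Submodule.mem_iSup_of_mem k (key _ (hI4 k)))

section Normal

variable {H : Type*} [NormedAddCommGroup H] [InnerProductSpace ℂ H] [CompleteSpace H]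

open ContinuousLinearMap

theorem IsStarNormal.adjoint_apply_of_apply_eq_smul {F : H →L[ℂ] H} (hF : IsStarNormal F)
    {μ : ℂ} {v : H} (hv : F v = μ • v) : adjoint F v = (starRingEnd ℂ) μ • v := by
  have hN : IsStarNormal (F - μ • (1 : H →L[ℂ] H)) := by
    refine ⟨?_⟩
    have h := hF.star_comm_self.eq
    simp only [commute_iff_eq, star_sub, star_smul, star_one, sub_mul, mul_sub, h, smul_mul_assoc,
      mul_smul_comm, one_mul, mul_one, smul_sub]
    rw [smul_comm μ (star μ) (1 : H →L[ℂ] H)]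
    abel
  have h := (ContinuousLinearMap.IsStarNormal.adjoint_apply_eq_zero_iff hN v).2 (by simp [hv])
  rw [← star_eq_adjoint] at h ⊢
  simpa [sub_eq_zero] using h

/-- If `F` is normal and `F*² = F²`, then the eigenspace of `F* F` for `ρ²` is the span of the
eigenspaces of `F` for the four points `iᵏ ρ`. -/
theorem IsStarNormal.iSup_eigenspace_eq {F : H →L[ℂ] H} (hF : IsStarNormal F)
    (hsq : ∀ v, adjoint F (adjoint F v) = F (F v)) {ρ : ℝ} (hρ : 0 < ρ) :
    ⨆ k : Fin 4, Module.End.eigenspace (F : H →ₗ[ℂ] H) (Complex.I ^ (k : ℕ) * (ρ : ℂ)) =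
      Module.End.eigenspace ((adjoint F).comp F : H →ₗ[ℂ] H) ((ρ : ℂ) ^ 2) := by
  have hcomm : ∀ v, adjoint F (F v) = F (adjoint F v) := fun v =>
    DFunLike.congr_fun hF.star_comm_self.eq v
  apply le_antisymm
  · refine iSup_le fun k v hv => ?_
    rw [Module.End.mem_eigenspace_iff] at hv ⊢
    have hv' : F v = (Complex.I ^ (k : ℕ) * (ρ : ℂ)) • v := hv
    change adjoint F (F v) = _
    rw [hv', map_smul, hF.adjoint_apply_of_apply_eq_smul hv', smul_smul]
    congr 1
    rw [Complex.mul_conj, Complex.normSq_eq_norm_sq]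
    simp
  · intro v hv
    have hv' : adjoint F (F v) = ((ρ : ℂ) ^ 2) • v := Module.End.mem_eigenspace_iff.1 hv
    refine Module.End.mem_iSup_eigenspace_of_pow_four _ (by exact_mod_cast hρ.ne') ?_
    change F (F (F (F v))) = _
    rw [← hsq, hcomm (F v), hv', map_smul, map_smul, hv', smul_smul]
    ring_nf

end Normal

section Fourier

variable {E : Set ℝ}

theorem measurePreserving_neg_restrict (hE : MeasurableSet E) (hsym : ∀ t : ℝ, t ∈ E ↔ -t ∈ E) :
    MeasurePreserving (fun t : ℝ => -t) (volume.restrict E) (volume.restrict E) := by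
  have h := (Measure.measurePreserving_neg (volume : Measure ℝ)).restrict_preimage hE
  have hpre : (Neg.neg ⁻¹' E : Set ℝ) = E := by
    ext t
    exact (hsym t).symm
  rwa [hpre] at h

theorem truncatedFourier_congr_ae {x y : ℝ → ℂ} (h : x =ᵐ[volume.restrict E] y) (t : ℝ) :
    truncatedFourier E x t = truncatedFourier E y t := by
  unfold truncatedFourier
  congr 1
  refine integral_congr_ae ?_
  filter_upwards [h] with ξ hξ
  rw [hξ]

theorem truncatedFourier_comp_neg (hE : MeasurableSet E) (hsym : ∀ t : ℝ, t ∈ E ↔ -t ∈ E)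
    (x : ℝ → ℂ) (t : ℝ) :
    truncatedFourier E (fun ξ => x (-ξ)) t = truncatedFourier E x (-t) := by
  unfold truncatedFourier
  congr 1
  rw [← (measurePreserving_neg_restrict hE hsym).integral_comp
    (MeasurableEquiv.neg ℝ).measurableEmbedding]
  refine integral_congr_ae (ae_of_all _ fun ξ => ?_)
  simp

/-- Fubini: the formal adjoint of `truncatedFourier` has the conjugate kernel. -/
theorem integral_truncatedFourier_mul_conj {x y : ℝ → ℂ}
    (hx : Integrable x (volume.restrict E)) (hy : Integrable y (volume.restrict E)) :
    ∫ t in E, y t * (starRingEnd ℂ) (truncatedFourier E x t) =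
      ∫ ξ in E, truncatedFourier E y (-ξ) * (starRingEnd ℂ) (x ξ) := by
  have hint : Integrable (Function.uncurry fun t ξ : ℝ =>
      y t * (starRingEnd ℂ) (x ξ) * Complex.exp (Complex.I * (-ξ : ℝ) * t))
      ((volume.restrict E).prod (volume.restrict E)) := by
    have hx' : Integrable (fun ξ => (starRingEnd ℂ) (x ξ)) (volume.restrict E) :=
      hx.norm.mono' (Complex.continuous_conj.comp_aestronglyMeasurable hx.1)
        (ae_of_all _ fun ξ => by simp)
    refine (hy.mul_prod hx').mono ?_ (ae_of_all _ fun p => ?_)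
    · refine (hy.mul_prod hx').1.mul (Continuous.aestronglyMeasurable ?_)
      fun_prop
    · have : ‖Complex.exp (Complex.I * (-p.2 : ℝ) * p.1)‖ = 1 := by
        rw [mul_assoc, mul_comm, ← Complex.ofReal_mul, Complex.norm_exp_ofReal_mul_I]
      simp only [Function.uncurry, norm_mul, this, mul_one, le_refl]
  have hswap := integral_integral_swap hint
  have hl : ∀ t, y t * (starRingEnd ℂ) (truncatedFourier E x t) =
      (((2 * Real.pi) ^ (-(1:ℝ)/2) : ℝ) : ℂ) *
        ∫ ξ in E, y t * (starRingEnd ℂ) (x ξ) * Complex.exp (Complex.I * (-ξ : ℝ) * t) := by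
    intro t
    unfold truncatedFourier
    rw [map_mul, Complex.conj_ofReal, ← integral_conj, mul_left_comm, ← integral_const_mul]
    congr 1
    refine integral_congr_ae (ae_of_all _ fun ξ => ?_)
    simp only [map_mul, ← Complex.exp_conj, Complex.conj_I, Complex.conj_ofReal,
      Complex.ofReal_neg]
    ring_nf
  have hr : ∀ ξ, truncatedFourier E y (-ξ) * (starRingEnd ℂ) (x ξ) =
      (((2 * Real.pi) ^ (-(1:ℝ)/2) : ℝ) : ℂ) *
        ∫ t in E, y t * (starRingEnd ℂ) (x ξ) * Complex.exp (Complex.I * (-ξ : ℝ) * t) := by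
    intro ξ
    unfold truncatedFourier
    rw [mul_assoc, ← integral_mul_const]
    congr 1
    refine integral_congr_ae (ae_of_all _ fun t => ?_)
    ring
  simp only [hl, hr, integral_const_mul, hswap]

theorem inner_truncatedFourier_left (hE : MeasurableSet E) (hsym : ∀ t : ℝ, t ∈ E ↔ -t ∈ E)
    (F : Lp ℂ 2 (volume.restrict E) →L[ℂ] Lp ℂ 2 (volume.restrict E))
    (hF : ∀ x : Lp ℂ 2 (volume.restrict E),
      ∀ᵐ t ∂(volume.restrict E), F x t = truncatedFourier E x t)
    (x y : Lp ℂ 2 (volume.restrict E)) :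
    inner ℂ (F x) y = inner ℂ x
      (F (Lp.compMeasurePreserving _ (measurePreserving_neg_restrict hE hsym) y)) := by
  have hJ := (Lp.isometry_compMeasurePreserving (E := ℂ) (p := 2)
    (measurePreserving_neg_restrict hE hsym)).continuous
  have hd := Lp.simpleFunc.denseRange (E := ℂ) (p := 2) (μ := volume.restrict E) (by simp)
  have hint : ∀ x : Lp.simpleFunc ℂ 2 (volume.restrict E),
      Integrable (x : Lp ℂ 2 (volume.restrict E)) (volume.restrict E) := fun x =>
    ((SimpleFunc.memLp_iff_integrable (by simp) (by simp)).1 (Lp.simpleFunc.memLp x)).congr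
      (Lp.simpleFunc.toSimpleFunc_eq_toFun x)
  refine hd.induction_on₂ (p := fun x y => inner ℂ (F x) y = inner ℂ x
      (F (Lp.compMeasurePreserving _ (measurePreserving_neg_restrict hE hsym) y)))
    (isClosed_eq (by fun_prop) (by fun_prop)) (fun x y => ?_) x y
  rw [L2.inner_def, L2.inner_def]
  simp only [RCLike.inner_apply]
  refine Eq.trans (integral_congr_ae ?_)
    ((integral_truncatedFourier_mul_conj (hint x) (hint y)).trans (integral_congr_ae ?_))
  · filter_upwards [hF x] with t ht
    rw [ht]
  · filter_upwards [hF (Lp.compMeasurePreserving _ (measurePreserving_neg_restrict hE hsym) y)]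
      with t ht
    rw [ht, truncatedFourier_congr_ae (Lp.coeFn_compMeasurePreserving _ _)]
    exact congrArg (· * _) (truncatedFourier_comp_neg hE hsym _ t).symm

/-- The truncated Fourier operator of a symmetric set commutes with reflection. -/
theorem truncatedFourier_reflection_comm (hE : MeasurableSet E)
    (hsym : ∀ t : ℝ, t ∈ E ↔ -t ∈ E)
    (F : Lp ℂ 2 (volume.restrict E) →L[ℂ] Lp ℂ 2 (volume.restrict E))
    (hF : ∀ x : Lp ℂ 2 (volume.restrict E),
      ∀ᵐ t ∂(volume.restrict E), F x t = truncatedFourier E x t)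
    (x : Lp ℂ 2 (volume.restrict E)) :
    F (Lp.compMeasurePreserving _ (measurePreserving_neg_restrict hE hsym) x) =
      Lp.compMeasurePreserving _ (measurePreserving_neg_restrict hE hsym) (F x) := by
  have hmp := measurePreserving_neg_restrict hE hsym
  ext1
  filter_upwards [hF (Lp.compMeasurePreserving _ hmp x), Lp.coeFn_compMeasurePreserving (F x) hmp,
    hmp.quasiMeasurePreserving.ae (hF x)] with t h1 h2 h3
  rw [h1, h2, Function.comp_apply, h3,
    truncatedFourier_congr_ae (Lp.coeFn_compMeasurePreserving _ _)]
  exact truncatedFourier_comp_neg hE hsym _ t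

theorem compMeasurePreserving_neg_neg (hE : MeasurableSet E) (hsym : ∀ t : ℝ, t ∈ E ↔ -t ∈ E)
    (x : Lp ℂ 2 (volume.restrict E)) :
    Lp.compMeasurePreserving _ (measurePreserving_neg_restrict hE hsym)
      (Lp.compMeasurePreserving _ (measurePreserving_neg_restrict hE hsym) x) = x := by
  have hmp := measurePreserving_neg_restrict hE hsym
  ext1
  filter_upwards [Lp.coeFn_compMeasurePreserving (Lp.compMeasurePreserving _ hmp x) hmp,
    hmp.quasiMeasurePreserving.ae (Lp.coeFn_compMeasurePreserving x hmp)] with t h1 h2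
  rw [h1, Function.comp_apply, h2, Function.comp_apply, neg_neg]

end Fourier

/-- For a symmetric measurable set `E ⊆ ℝ` and `ρ > 0`: if `ρ²` is an eigenvalue of
`𝓕_E* 𝓕_E` whose eigenspace has finite dimension `κ`, then at least one of the four points
`i^k ρ`, `k = 0,1,2,3`, is an eigenvalue of `𝓕_E`, and the total multiplicity
`∑_{k=0}^{3} dim ker(𝓕_E - i^k ρ I)` equals `κ`. In particular, if `κ = 1` then exactly one
of the four points `i^k ρ` is an eigenvalue of `𝓕_E`, and that eigenvalue is simple. -/
theorem truncatedFourier_eigenvalue_multiplicities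
    (E : Set ℝ) (hE : MeasurableSet E) (hsym : ∀ t : ℝ, t ∈ E ↔ -t ∈ E)
    (F : Lp ℂ 2 (volume.restrict E) →L[ℂ] Lp ℂ 2 (volume.restrict E))
    (hF : ∀ x : Lp ℂ 2 (volume.restrict E),
      ∀ᵐ t ∂(volume.restrict E), F x t = truncatedFourier E x t)
    (ρ : ℝ) (hρ : 0 < ρ) (κ : ℕ)
    (hev : Module.End.HasEigenvalue
      (((ContinuousLinearMap.adjoint F).comp F : Lp ℂ 2 (volume.restrict E) →ₗ[ℂ]
        Lp ℂ 2 (volume.restrict E))) ((ρ : ℂ) ^ 2))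
    (hfin : FiniteDimensional ℂ (Module.End.eigenspace
      (((ContinuousLinearMap.adjoint F).comp F : Lp ℂ 2 (volume.restrict E) →ₗ[ℂ]
        Lp ℂ 2 (volume.restrict E))) ((ρ : ℂ) ^ 2)))
    (hκ : Module.finrank ℂ (Module.End.eigenspace
      (((ContinuousLinearMap.adjoint F).comp F : Lp ℂ 2 (volume.restrict E) →ₗ[ℂ]
        Lp ℂ 2 (volume.restrict E))) ((ρ : ℂ) ^ 2)) = κ) :
    (∃ k : Fin 4, Module.End.HasEigenvalue
      ((F : Lp ℂ 2 (volume.restrict E) →ₗ[ℂ] Lp ℂ 2 (volume.restrict E)))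
      (Complex.I ^ (k : ℕ) * (ρ : ℂ))) ∧
    (∀ k : Fin 4, FiniteDimensional ℂ (Module.End.eigenspace
      ((F : Lp ℂ 2 (volume.restrict E) →ₗ[ℂ] Lp ℂ 2 (volume.restrict E)))
      (Complex.I ^ (k : ℕ) * (ρ : ℂ)))) ∧
    (∑ k : Fin 4, Module.finrank ℂ (Module.End.eigenspace
      ((F : Lp ℂ 2 (volume.restrict E) →ₗ[ℂ] Lp ℂ 2 (volume.restrict E)))
      (Complex.I ^ (k : ℕ) * (ρ : ℂ)))) = κ ∧
    (κ = 1 →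
      (∃! k : Fin 4, Module.End.HasEigenvalue
        ((F : Lp ℂ 2 (volume.restrict E) →ₗ[ℂ] Lp ℂ 2 (volume.restrict E)))
        (Complex.I ^ (k : ℕ) * (ρ : ℂ))) ∧
      (∀ k : Fin 4, Module.End.HasEigenvalue
        ((F : Lp ℂ 2 (volume.restrict E) →ₗ[ℂ] Lp ℂ 2 (volume.restrict E)))
        (Complex.I ^ (k : ℕ) * (ρ : ℂ)) →
        Module.finrank ℂ (Module.End.eigenspace
          ((F : Lp ℂ 2 (volume.restrict E) →ₗ[ℂ] Lp ℂ 2 (volume.restrict E)))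
          (Complex.I ^ (k : ℕ) * (ρ : ℂ))) = 1)) := by
  have hmp := measurePreserving_neg_restrict hE hsym
  have hadj : ∀ v, ContinuousLinearMap.adjoint F v = F (Lp.compMeasurePreserving _ hmp v) :=
    fun v => ext_inner_left ℂ fun w => by
      rw [ContinuousLinearMap.adjoint_inner_right, inner_truncatedFourier_left hE hsym F hF]
  have hcomm := truncatedFourier_reflection_comm hE hsym F hF
  have hN : IsStarNormal F := by
    refine ⟨ContinuousLinearMap.ext fun v => ?_⟩
    change ContinuousLinearMap.adjoint F (F v) = F (ContinuousLinearMap.adjoint F v)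
    rw [hadj, hadj, hcomm v]
  have hsup := hN.iSup_eigenspace_eq (fun v => by
    rw [hadj, hadj, ← hcomm, compMeasurePreserving_neg_neg hE hsym]) hρ
  have hρ' : (ρ : ℂ) ≠ 0 := by exact_mod_cast hρ.ne'
  have hind := (Module.End.eigenspaces_iSupIndep (F : Lp ℂ 2 (volume.restrict E) →ₗ[ℂ]
    Lp ℂ 2 (volume.restrict E))).comp (Complex.I_pow_mul_injective hρ')
  have hfd : ∀ k : Fin 4, FiniteDimensional ℂ (Module.End.eigenspace
      (F : Lp ℂ 2 (volume.restrict E) →ₗ[ℂ] Lp ℂ 2 (volume.restrict E))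
      (Complex.I ^ (k : ℕ) * (ρ : ℂ))) := fun k =>
    Submodule.finiteDimensional_of_le ((le_iSup (fun k : Fin 4 => Module.End.eigenspace
      (F : Lp ℂ 2 (volume.restrict E) →ₗ[ℂ] Lp ℂ 2 (volume.restrict E))
      (Complex.I ^ (k : ℕ) * (ρ : ℂ))) k).trans hsup.le)
  have hsum : (∑ k : Fin 4, Module.finrank ℂ (Module.End.eigenspace
      (F : Lp ℂ 2 (volume.restrict E) →ₗ[ℂ] Lp ℂ 2 (volume.restrict E))
      (Complex.I ^ (k : ℕ) * (ρ : ℂ)))) = κ := by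
    rw [← hκ, ← hsup]
    exact (iSupIndep.finrank_iSup (p := fun k : Fin 4 => Module.End.eigenspace
      (F : Lp ℂ 2 (volume.restrict E) →ₗ[ℂ] Lp ℂ 2 (volume.restrict E))
      (Complex.I ^ (k : ℕ) * (ρ : ℂ))) hind).symm
  have hκ0 : κ ≠ 0 := by
    rw [← hκ]
    exact fun h => hev (Submodule.finrank_eq_zero.1 h)
  have hiff : ∀ k : Fin 4, Module.End.HasEigenvalue
      (F : Lp ℂ 2 (volume.restrict E) →ₗ[ℂ] Lp ℂ 2 (volume.restrict E))
      (Complex.I ^ (k : ℕ) * (ρ : ℂ)) ↔ Module.finrank ℂ (Module.End.eigenspace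
      (F : Lp ℂ 2 (volume.restrict E) →ₗ[ℂ] Lp ℂ 2 (volume.restrict E))
      (Complex.I ^ (k : ℕ) * (ρ : ℂ))) ≠ 0 := fun k =>
    (not_congr Submodule.finrank_eq_zero).symm
  simp only [hiff]
  have hex : ∃ k : Fin 4, Module.finrank ℂ (Module.End.eigenspace
      (F : Lp ℂ 2 (volume.restrict E) →ₗ[ℂ] Lp ℂ 2 (volume.restrict E))
      (Complex.I ^ (k : ℕ) * (ρ : ℂ))) ≠ 0 := by
    by_contra! h
    exact hκ0 (hsum.symm.trans (Finset.sum_eq_zero fun k _ => h k))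
  refine ⟨hex, hfd, hsum, fun h1 => ?_⟩
  obtain ⟨k, hk⟩ := hex
  rw [h1, ← Finset.add_sum_erase _ _ (Finset.mem_univ k)] at hsum
  have hrest := Finset.sum_eq_zero_iff.1 (Nat.eq_zero_of_le_zero
    (Nat.le_of_add_le_add_left ((hsum.le.trans (Nat.one_le_iff_ne_zero.2 hk)).trans_eq
      (Nat.add_zero _).symm)))
  have huniq : ∀ j : Fin 4, Module.finrank ℂ (Module.End.eigenspace
      (F : Lp ℂ 2 (volume.restrict E) →ₗ[ℂ] Lp ℂ 2 (volume.restrict E))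
      (Complex.I ^ (j : ℕ) * (ρ : ℂ))) ≠ 0 → j = k := fun j hj => by
    by_contra hne
    exact hj (hrest j (Finset.mem_erase.2 ⟨hne, Finset.mem_univ j⟩))
  refine ⟨⟨k, hk, huniq⟩, fun j hj => ?_⟩
  rw [huniq j hj]
  omega
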